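/- Let A and B be dendriform algebras. Then A⊗B is a quadri-algebra with operations (a₁⊗b₁)↖(a₂⊗b₂) = (a₁≺a₂)⊗(b₁≺b₂), (a₁⊗b₁)↙(a₂⊗b₂) = (a₁≺a₂)⊗(b₁≻b₂), (a₁⊗b₁)↗(a₂⊗b₂) = (a₁≻a₂)⊗(b₁≺b₂), (a₁⊗b₁)↘(a₂⊗b₂) = (a₁≻a₂)⊗(b₁≻b₂); i.e., these four operations satisfy the nine quadri-algebra axioms. -/

import Mathlib

def IsQuadri {Q : Type*} [AddCommGroup Q] (se nea nw sw : Q → Q → Q) : Prop :=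
  ∀ x y z : Q,
    nw (nw x y) z = nw x (se y z + nea y z + nw y z + sw y z) ∧
    nw (nea x y) z = nea x (nw y z + sw y z) ∧
    nea (nea x y + nw x y) z = nea x (nea y z + se y z) ∧
    nw (sw x y) z = sw x (nea y z + nw y z) ∧
    nw (se x y) z = se x (nw y z) ∧
    nea (se x y + sw x y) z = se x (nea y z) ∧
    sw (nw x y + sw x y) z = sw x (se y z + sw y z) ∧
    sw (nea x y + se x y) z = se x (sw y z) ∧
    se (se x y + nea x y + nw x y + sw x y) z = se x (se y z)

def IsDendriform {D : Type*} [AddCommGroup D] (p s : D → D → D) : Prop :=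
  ∀ x y z : D,
    p (p x y) z = p x (p y z) + p x (s y z) ∧
    p (s x y) z = s x (p y z) ∧
    s (p x y) z + s (s x y) z = s x (s y z)

open TensorProduct in
theorem tensor_of_dendriform_is_quadri {K A B : Type*} [Field K]
    [AddCommGroup A] [Module K A] [AddCommGroup B] [Module K B]
    (pA sA : A →ₗ[K] A →ₗ[K] A) (pB sB : B →ₗ[K] B →ₗ[K] B)
    (hA : IsDendriform (fun a b => pA a b) (fun a b => sA a b))
    (hB : IsDendriform (fun a b => pB a b) (fun a b => sB a b)) :
    IsQuadri (Q := A ⊗[K] B)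
      (fun x y => TensorProduct.map₂ sA sB x y)
      (fun x y => TensorProduct.map₂ sA pB x y)
      (fun x y => TensorProduct.map₂ pA pB x y)
      (fun x y => TensorProduct.map₂ pA sB x y) := by
  intro x y z
  induction x using TensorProduct.induction_on with
  | zero => simp
  | add x x' hx hx' =>
    obtain ⟨h1, h2, h3, h4, h5, h6, h7, h8, h9⟩ := hx
    obtain ⟨k1, k2, k3, k4, k5, k6, k7, k8, k9⟩ := hx'
    simp only [map_add, LinearMap.add_apply] at *
    refine ⟨?_, ?_, ?_, ?_, ?_, ?_, ?_, ?_, ?_⟩ <;> grind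
  | tmul a b =>
  induction y using TensorProduct.induction_on with
  | zero => simp
  | add x x' hx hx' =>
    obtain ⟨h1, h2, h3, h4, h5, h6, h7, h8, h9⟩ := hx
    obtain ⟨k1, k2, k3, k4, k5, k6, k7, k8, k9⟩ := hx'
    simp only [map_add, LinearMap.add_apply] at *
    refine ⟨?_, ?_, ?_, ?_, ?_, ?_, ?_, ?_, ?_⟩ <;> grind
  | tmul a' b' =>
  induction z using TensorProduct.induction_on with
  | zero => simp
  | add x x' hx hx' =>
    obtain ⟨h1, h2, h3, h4, h5, h6, h7, h8, h9⟩ := hx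
    obtain ⟨k1, k2, k3, k4, k5, k6, k7, k8, k9⟩ := hx'
    simp only [map_add, LinearMap.add_apply] at *
    refine ⟨?_, ?_, ?_, ?_, ?_, ?_, ?_, ?_, ?_⟩ <;> grind
  | tmul a'' b'' =>
    obtain ⟨h1, h2, h3⟩ := hA a a' a''
    obtain ⟨k1, k2, k3⟩ := hB b b' b''
    dsimp only at h1 h2 h3 k1 k2 k3
    refine ⟨?_, ?_, ?_, ?_, ?_, ?_, ?_, ?_, ?_⟩ <;>
    simp only [map_add, LinearMap.add_apply, TensorProduct.map₂_apply_tmul,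
      TensorProduct.map_tmul, h1, h2, ← h3, k1, k2, ← k3, TensorProduct.add_tmul,
      TensorProduct.tmul_add] <;> abel
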